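/- arXiv:2503.17130 — 5 statements merged into one kernel-verified Lean document; each statement's English description precedes it below -/
import Mathlib

section
/- Let C and D be categories, let Φ : C ⥤ D be a functor, and let F, G be ℝ-diagrams in C. Then d_I(F ⋙ Φ, G ⋙ Φ) ≤ d_I(F, G); that is, post-composition with a functor does not increase the interleaving distance. -/
open CategoryTheory
open scoped ENNReal

/-- Two `ℝ`-diagrams `F G : ℝ ⥤ C` are `δ`-interleaved (for `δ ≥ 0`) if there are
families of morphisms `φ_r : F r ⟶ G (r + δ)` and `ψ_r : G r ⟶ F (r + δ)`, natural in `r`,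
whose composites recover the structure maps `F (r ≤ r + 2δ)` and `G (r ≤ r + 2δ)`. -/
def Interleaved {C : Type*} [Category C] (δ : ℝ) (hδ : 0 ≤ δ) (F G : ℝ ⥤ C) : Prop :=
  ∃ (φ : ∀ r : ℝ, F.obj r ⟶ G.obj (r + δ)) (ψ : ∀ r : ℝ, G.obj r ⟶ F.obj (r + δ)),
    (∀ (s t : ℝ) (h : s ≤ t),
        F.map (homOfLE h) ≫ φ t = φ s ≫ G.map (homOfLE (add_le_add_left h δ))) ∧
    (∀ (s t : ℝ) (h : s ≤ t),
        G.map (homOfLE h) ≫ ψ t = ψ s ≫ F.map (homOfLE (add_le_add_left h δ))) ∧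
    (∀ r : ℝ, φ r ≫ ψ (r + δ) =
        F.map (homOfLE (by linarith : r ≤ r + δ + δ))) ∧
    (∀ r : ℝ, ψ r ≫ φ (r + δ) =
        G.map (homOfLE (by linarith : r ≤ r + δ + δ)))

/-- The interleaving distance between two `ℝ`-diagrams, valued in `ℝ≥0∞`: the infimum of
the set of `δ ≥ 0` such that the diagrams are `δ`-interleaved. -/
noncomputable def interleavingDist {C : Type*} [Category C] (F G : ℝ ⥤ C) : ℝ≥0∞ :=
  sInf {e : ℝ≥0∞ | ∃ (δ : ℝ) (hδ : 0 ≤ δ), e = ENNReal.ofReal δ ∧ Interleaved δ hδ F G}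

/-- A functor carries a `δ`-interleaving to a `δ`-interleaving. -/
theorem Interleaved.comp {C D : Type*} [Category C] [Category D] {δ : ℝ} {hδ : 0 ≤ δ}
    {F G : ℝ ⥤ C} (h : Interleaved δ hδ F G) (Φ : C ⥤ D) :
    Interleaved δ hδ (F ⋙ Φ) (G ⋙ Φ) := by
  obtain ⟨φ, ψ, hφ, hψ, hφψ, hψφ⟩ := h
  refine ⟨fun r => Φ.map (φ r), fun r => Φ.map (ψ r), fun s t h => ?_, fun s t h => ?_,
    fun r => ?_, fun r => ?_⟩
  · simp only [Functor.comp_map, ← Φ.map_comp, hφ s t h]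
  · simp only [Functor.comp_map, ← Φ.map_comp, hψ s t h]
  · simp only [Functor.comp_map, ← Φ.map_comp, hφψ r]
  · simp only [Functor.comp_map, ← Φ.map_comp, hψφ r]

/-- Post-composition with a functor does not increase the interleaving distance. -/
theorem interleavingDist_comp_le {C D : Type*} [Category C] [Category D] (Φ : C ⥤ D)
    (F G : ℝ ⥤ C) :
    interleavingDist (F ⋙ Φ) (G ⋙ Φ) ≤ interleavingDist F G := by
  refine sInf_le_sInf ?_
  rintro _ ⟨δ, hδ, rfl, h⟩
  exact ⟨δ, hδ, rfl, h.comp Φ⟩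
end

section
/- Let k be a field, C a category, H, H' : C ⥤ ModuleCat k functors, and θ : H ⟶ H' a natural transformation. Let F, G be ℝ-diagrams in C and let f : F ⟶ G be a natural transformation such that for every r ∈ ℝ both H(f_r) and H'(f_r) are isomorphisms. Then img_θ(F) and img_θ(G) are isomorphic as persistence modules (i.e., naturally isomorphic as functors ℝ ⥤ ModuleCat k). -/
open CategoryTheory

variable {k : Type*} [Field k]

/-- The image of a natural transformation of persistence modules: pointwise the range,
with structure maps the restrictions of those of the target (well defined by naturality). -/
noncomputable def imgFunctor {M N : ℝ ⥤ ModuleCat k} (f : M ⟶ N) : ℝ ⥤ ModuleCat k where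
  obj r := ModuleCat.of k (LinearMap.range (f.app r).hom)
  map {s t} h := ModuleCat.ofHom <| (N.map h).hom.restrict (p := LinearMap.range (f.app s).hom)
    (q := LinearMap.range (f.app t).hom) (fun x hx => by
      obtain ⟨y, rfl⟩ := hx
      refine ⟨M.map h y, ?_⟩
      have : (M.map h ≫ f.app t) y = (f.app s ≫ N.map h) y := by rw [f.naturality h]
      exact this)
  map_id r := by
    ext x
    show N.map (𝟙 r) x.val = x.val
    simp
  map_comp {s t u} h h' := by
    ext x
    show N.map (h ≫ h') x.val = N.map h' (N.map h x.val)
    simp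

/-- The kernel of a natural transformation of persistence modules: pointwise the kernel,
with structure maps the restrictions of those of the source (well defined by naturality). -/
noncomputable def kerFunctor {M N : ℝ ⥤ ModuleCat k} (f : M ⟶ N) : ℝ ⥤ ModuleCat k where
  obj r := ModuleCat.of k (LinearMap.ker (f.app r).hom)
  map {s t} h := ModuleCat.ofHom <| (M.map h).hom.restrict (p := LinearMap.ker (f.app s).hom)
    (q := LinearMap.ker (f.app t).hom) (fun x hx => by
      simp only [LinearMap.mem_ker] at hx ⊢
      have : (M.map h ≫ f.app t) x = (f.app s ≫ N.map h) x := by rw [f.naturality h]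
      show (M.map h ≫ f.app t) x = 0
      rw [this]
      show N.map h (f.app s x) = 0
      rw [hx]
      simp)
  map_id r := by
    ext x
    show M.map (𝟙 r) x.val = x.val
    simp
  map_comp {s t u} h h' := by
    ext x
    show M.map (h ≫ h') x.val = M.map h' (M.map h x.val)
    simp

/-- Given a natural transformation `θ : H ⟶ H'` (a linear cohomology operation) and an
`ℝ`-diagram `F` in `C`, the induced natural transformation `θF : F ⋙ H ⟶ F ⋙ H'`
of persistence modules. -/
def thetaF {C : Type*} [Category C] {H H' : C ⥤ ModuleCat k} (θ : H ⟶ H')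
    (F : ℝ ⥤ C) : (F ⋙ H) ⟶ (F ⋙ H') :=
  Functor.whiskerLeft F θ

/-- `img_θ(F)`, the image persistence module of the operation `θ` on the diagram `F`. -/
noncomputable def imgTheta {C : Type*} [Category C] {H H' : C ⥤ ModuleCat k} (θ : H ⟶ H')
    (F : ℝ ⥤ C) : ℝ ⥤ ModuleCat k :=
  imgFunctor (thetaF θ F)

/-- `ker_θ(F)`, the kernel persistence module of the operation `θ` on the diagram `F`. -/
noncomputable def kerTheta {C : Type*} [Category C] {H H' : C ⥤ ModuleCat k} (θ : H ⟶ H')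
    (F : ℝ ⥤ C) : ℝ ⥤ ModuleCat k :=
  kerFunctor (thetaF θ F)

/-- The morphism of image persistence modules induced by a commutative square. -/
noncomputable def imgFunctorMap {M N M' N' : ℝ ⥤ ModuleCat k} {f : M ⟶ N} {f' : M' ⟶ N'}
    (a : M ⟶ M') (b : N ⟶ N') (w : f ≫ b = a ≫ f') : imgFunctor f ⟶ imgFunctor f' where
  app r := ModuleCat.ofHom <| (b.app r).hom.restrict (p := LinearMap.range (f.app r).hom)
    (q := LinearMap.range (f'.app r).hom) (by
      rintro _ ⟨y, rfl⟩
      refine ⟨a.app r y, ?_⟩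
      have h : (a ≫ f').app r y = (f ≫ b).app r y := by rw [w]
      exact h)
  naturality s t h := by
    ext x
    have e : (N.map h ≫ b.app t) x.val = (b.app s ≫ N'.map h) x.val := by rw [b.naturality h]
    exact Subtype.ext e

/-- Isomorphic natural transformations have isomorphic images. -/
noncomputable def imgFunctorIso {M N M' N' : ℝ ⥤ ModuleCat k} {f : M ⟶ N} {f' : M' ⟶ N'}
    (a : M ≅ M') (b : N ≅ N') (w : f ≫ b.hom = a.hom ≫ f') : imgFunctor f ≅ imgFunctor f' where
  hom := imgFunctorMap a.hom b.hom w
  inv := imgFunctorMap a.inv b.inv (by rw [Iso.comp_inv_eq, Category.assoc, w, Iso.inv_hom_id_assoc])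
  hom_inv_id := by
    ext r x
    have e : (b.hom ≫ b.inv).app r x.val = x.val := by rw [b.hom_inv_id]; rfl
    exact Subtype.ext e
  inv_hom_id := by
    ext r x
    have e : (b.inv ≫ b.hom).app r x.val = x.val := by rw [b.inv_hom_id]; rfl
    exact Subtype.ext e

/-- If `f : F ⟶ G` induces isomorphisms under both `H` and `H'` at every `r : ℝ`, then the
image persistence modules `img_θ(F)` and `img_θ(G)` are isomorphic. -/
theorem imgTheta_iso_of_weakEquiv {C : Type*} [Category C]
    {H H' : C ⥤ ModuleCat k} (θ : H ⟶ H') (F G : ℝ ⥤ C) (f : F ⟶ G)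
    (hH : ∀ r : ℝ, IsIso (H.map (f.app r))) (hH' : ∀ r : ℝ, IsIso (H'.map (f.app r))) :
    Nonempty (imgTheta θ F ≅ imgTheta θ G) := by
  exact ⟨imgFunctorIso
    (NatIso.ofComponents (fun r => asIso (H.map (f.app r))) (by simp [← Functor.map_comp]))
    (NatIso.ofComponents (fun r => asIso (H'.map (f.app r))) (by simp [← Functor.map_comp]))
    (by ext1; ext1 r; exact (θ.naturality (f.app r)).symm)⟩
end

section
/- Let k be a field, C a category, H, H' : C ⥤ ModuleCat k functors, and θ : H ⟶ H' a natural transformation. Let F, G be ℝ-diagrams in C and let f : F ⟶ G be a natural transformation such that for every r ∈ ℝ both H(f_r) and H'(f_r) are isomorphisms. Then ker_θ(F) and ker_θ(G) are isomorphic as persistence modules (i.e., naturally isomorphic as functors ℝ ⥤ ModuleCat k). -/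
open CategoryTheory

variable {k : Type*} [Field k]

/-- A commutative square of persistence modules induces a morphism between the kernels. -/
noncomputable def kerFunctorMap {M N M' N' : ℝ ⥤ ModuleCat k} (φ : M ⟶ N) (ψ : M' ⟶ N')
    (α : M ⟶ M') (β : N ⟶ N') (w : φ ≫ β = α ≫ ψ) : kerFunctor φ ⟶ kerFunctor ψ where
  app r := ModuleCat.ofHom <| (α.app r).hom.restrict (p := LinearMap.ker (φ.app r).hom)
    (q := LinearMap.ker (ψ.app r).hom) (fun x hx => by
      have hx : φ.app r x = 0 := hx
      have hw : β.app r (φ.app r x) = ψ.app r (α.app r x) :=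
        ConcreteCategory.congr_hom (NatTrans.congr_app w r) x
      rw [hx, map_zero] at hw
      exact hw.symm)
  naturality s t h := by
    ext x
    exact Subtype.ext (ConcreteCategory.congr_hom (α.naturality h) x.val)

/-- Isomorphic morphisms of persistence modules have isomorphic kernels. -/
noncomputable def kerFunctorIso {M N M' N' : ℝ ⥤ ModuleCat k} (φ : M ⟶ N) (ψ : M' ⟶ N')
    (α : M ≅ M') (β : N ≅ N') (w : φ ≫ β.hom = α.hom ≫ ψ) :
    kerFunctor φ ≅ kerFunctor ψ where
  hom := kerFunctorMap φ ψ α.hom β.hom w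
  inv := kerFunctorMap ψ φ α.inv β.inv (by
    rw [Iso.eq_inv_comp, ← Category.assoc, ← w, Category.assoc, Iso.hom_inv_id,
      Category.comp_id])
  hom_inv_id := by
    ext r x
    exact Subtype.ext (ConcreteCategory.congr_hom (NatTrans.congr_app α.hom_inv_id r) x.val)
  inv_hom_id := by
    ext r x
    exact Subtype.ext (ConcreteCategory.congr_hom (NatTrans.congr_app α.inv_hom_id r) x.val)

/-- If `f : F ⟶ G` induces isomorphisms under both `H` and `H'` at every `r : ℝ`, then the
kernel persistence modules `ker_θ(F)` and `ker_θ(G)` are isomorphic. -/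
theorem kerTheta_iso_of_weakEquiv {C : Type*} [Category C]
    {H H' : C ⥤ ModuleCat k} (θ : H ⟶ H') (F G : ℝ ⥤ C) (f : F ⟶ G)
    (hH : ∀ r : ℝ, IsIso (H.map (f.app r))) (hH' : ∀ r : ℝ, IsIso (H'.map (f.app r))) :
    Nonempty (kerTheta θ F ≅ kerTheta θ G) := by
  have hα : ∀ r, IsIso ((Functor.whiskerRight f H).app r) := hH
  have hβ : ∀ r, IsIso ((Functor.whiskerRight f H').app r) := hH'
  have := NatIso.isIso_of_isIso_app (Functor.whiskerRight f H)
  have := NatIso.isIso_of_isIso_app (Functor.whiskerRight f H')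
  refine ⟨kerFunctorIso _ _ (asIso (Functor.whiskerRight f H))
    (asIso (Functor.whiskerRight f H')) ?_⟩
  ext1
  funext r
  exact (θ.naturality (f.app r)).symm
end

section
/- Let k be a field, C a category, H, H' : C ⥤ ModuleCat k functors, and θ : H ⟶ H' a natural transformation. Let δ ≥ 0 and let F, G be ℝ-diagrams in C that are δ-interleaved. Then the image persistence modules img_θ(F) and img_θ(G) are δ-interleaved (an interleaving is given by the restrictions of H'(φ_r) and H'(ψ_r) to the images, which are well-defined by naturality of θ). -/
open CategoryTheory

variable {k : Type*} [Field k]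

/-- The image of a natural transformation between module-valued functors: pointwise the range,
with structure maps the restrictions of those of the target. -/
noncomputable def rangeFunctor {C : Type*} [Category C] {H H' : C ⥤ ModuleCat k} (θ : H ⟶ H') :
    C ⥤ ModuleCat k where
  obj X := ModuleCat.of k (LinearMap.range (θ.app X).hom)
  map {X Y} g := ModuleCat.ofHom <| (H'.map g).hom.restrict
    (p := LinearMap.range (θ.app X).hom) (q := LinearMap.range (θ.app Y).hom) (by
      rintro _ ⟨y, rfl⟩
      exact ⟨H.map g y, ConcreteCategory.congr_hom (θ.naturality g) y⟩)
  map_id X := by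
    ext x
    change H'.map (𝟙 X) x.val = x.val
    simp
  map_comp g g' := by
    ext x
    change H'.map (g ≫ g') x.val = H'.map g' (H'.map g x.val)
    simp

/-- The image persistence module of `θ` on `F` is `F` followed by the image functor of `θ`. -/
theorem imgTheta_eq_comp_rangeFunctor {C : Type*} [Category C] {H H' : C ⥤ ModuleCat k}
    (θ : H ⟶ H') (F : ℝ ⥤ C) : imgTheta θ F = F ⋙ rangeFunctor θ :=
  rfl

/-- Functors preserve interleavings. -/
theorem Interleaved.comp_functor {C D : Type*} [Category C] [Category D] {δ : ℝ} {hδ : 0 ≤ δ}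
    {F G : ℝ ⥤ C} (h : Interleaved δ hδ F G) (K : C ⥤ D) :
    Interleaved δ hδ (F ⋙ K) (G ⋙ K) := by
  obtain ⟨φ, ψ, hφ, hψ, hφψ, hψφ⟩ := h
  refine ⟨fun r => K.map (φ r), fun r => K.map (ψ r), fun s t h => ?_, fun s t h => ?_,
    fun r => ?_, fun r => ?_⟩
  · simp only [Functor.comp_map, ← K.map_comp, hφ s t h]
  · simp only [Functor.comp_map, ← K.map_comp, hψ s t h]
  · simp only [Functor.comp_map, ← K.map_comp, hφψ r]
  · simp only [Functor.comp_map, ← K.map_comp, hψφ r]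

/-- If `F` and `G` are `δ`-interleaved `ℝ`-diagrams in `C`, then the image persistence
modules `img_θ(F)` and `img_θ(G)` are `δ`-interleaved. -/
theorem imgTheta_interleaved {C : Type*} [Category C]
    {H H' : C ⥤ ModuleCat k} (θ : H ⟶ H') (δ : ℝ) (hδ : 0 ≤ δ) (F G : ℝ ⥤ C)
    (h : Interleaved δ hδ F G) :
    Interleaved δ hδ (imgTheta θ F) (imgTheta θ G) := by
  rw [imgTheta_eq_comp_rangeFunctor, imgTheta_eq_comp_rangeFunctor]
  exact h.comp_functor (rangeFunctor θ)
end

section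
/- Let q ≥ 2 be a natural number, let ω = exp(2πi/q) ∈ ℂ, and let r be a real number with 0 < r ≤ 2π/(q(q+1)). Let x, y be unit vectors in a complex inner product space and let c be an integer with c not congruent to 0 modulo q. Then it is not the case that both d_S(x, y) < r and d_S(x, ω^c • y) < r, where d_S(u, v) = arccos(re⟪u, v⟫) is the geodesic distance on the unit sphere. -/
open Real

/-- The geodesic distance on the unit sphere of a complex inner product space:
`d_S(x, y) = arccos (re ⟪x, y⟫)`. -/
noncomputable def sphereDist {E : Type*} [NormedAddCommGroup E] [InnerProductSpace ℂ E]
    (x y : E) : ℝ :=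
  Real.arccos (inner ℂ x y : ℂ).re

theorem sphereDist_comm {E : Type*} [NormedAddCommGroup E] [InnerProductSpace ℂ E] (x y : E) :
    sphereDist x y = sphereDist y x := by
  rw [sphereDist, sphereDist, ← inner_conj_symm, Complex.conj_re]

theorem sphereDist_triangle {E : Type*} [NormedAddCommGroup E] [InnerProductSpace ℂ E]
    {x y z : E} (hx : ‖x‖ = 1) (hy : ‖y‖ = 1) (hz : ‖z‖ = 1) :
    sphereDist x z ≤ sphereDist x y + sphereDist y z := by
  let : InnerProductSpace ℝ E := InnerProductSpace.rclikeToReal ℂ E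
  have h {u v : E} (hu : ‖u‖ = 1) (hv : ‖v‖ = 1) :
      sphereDist u v = InnerProductGeometry.angle u v := by
    simp [sphereDist, InnerProductGeometry.angle, hu, hv, real_inner_eq_re_inner ℂ]
  rw [h hx hy, h hy hz, h hx hz]
  exact InnerProductGeometry.angle_le_angle_add_angle x y z

theorem sphereDist_exp_smul {E : Type*} [NormedAddCommGroup E] [InnerProductSpace ℂ E]
    {y : E} (hy : ‖y‖ = 1) (θ : ℝ) :
    sphereDist y (Complex.exp (θ * Complex.I) • y) = arccos (cos θ) := by
  rw [sphereDist, inner_smul_right, inner_self_eq_norm_sq_to_K, hy]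
  simp [Complex.exp_ofReal_mul_I_re]

theorem le_arccos_cos {a θ : ℝ} (ha₀ : 0 ≤ a) (hθ : a ≤ θ) (hθ' : θ ≤ 2 * π - a) :
    a ≤ arccos (cos θ) := by
  rcases le_total θ π with h | h
  · rwa [arccos_cos (ha₀.trans hθ) h]
  · rw [← cos_two_pi_sub, arccos_cos (by linarith) (by linarith)]
    linarith

/-- The principal angle of a nontrivial multiple of `2π / q` is at least `2π / q`. -/
theorem two_pi_div_le_arccos_cos {q : ℕ} (hq : 0 < q) {c : ℤ} (hc : ¬ (q : ℤ) ∣ c) :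
    2 * π / q ≤ arccos (cos (c * (2 * π / q))) := by
  have hq' : (0 : ℝ) < q := by exact_mod_cast hq
  have hqz : (0 : ℤ) < q := by exact_mod_cast hq
  have hd₀ : (1 : ℤ) ≤ c % q := Int.emod_pos_of_not_dvd hc |>.resolve_left hqz.ne'
  have hd₁ : c % q + 1 ≤ q := Int.emod_lt_of_pos c hqz
  have hd₀' : (1 : ℝ) ≤ (c % q : ℤ) := by exact_mod_cast hd₀
  have hd₁' : ((c % q : ℤ) : ℝ) + 1 ≤ q := by exact_mod_cast hd₁
  have hcq : (c : ℝ) = (c % q : ℤ) + q * (c / q : ℤ) := by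
    exact_mod_cast (Int.emod_add_mul_ediv c q).symm
  have hper : (c : ℝ) * (2 * π / q) = (c % q : ℤ) * (2 * π / q) + (c / q : ℤ) * (2 * π) := by
    rw [hcq]
    field_simp
  have ha : 0 ≤ 2 * π / q := by positivity
  have hqa : q * (2 * π / q) = 2 * π := by field_simp
  rw [hper, cos_add_int_mul_two_pi]
  exact le_arccos_cos ha (by nlinarith) (by nlinarith)

/-- For `q ≥ 2`, `ω = exp(2πi/q)`, `0 < r ≤ 2π/(q(q+1))`, unit vectors `x, y`, and an
integer `c` not congruent to `0` mod `q`, the geodesic sphere distances `d_S(x, y)` and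
`d_S(x, ω^c • y)` cannot both be `< r`. -/
theorem not_both_sphereDist_lt {E : Type*} [NormedAddCommGroup E]
    [InnerProductSpace ℂ E] (q : ℕ) (hq : 2 ≤ q)
    (ω : ℂ) (hω : ω = Complex.exp (2 * π * Complex.I / q))
    (r : ℝ) (hr₀ : 0 < r) (hr : r ≤ 2 * π / (q * (q + 1)))
    (x y : E) (hx : ‖x‖ = 1) (hy : ‖y‖ = 1)
    (c : ℤ) (hc : ¬ ((q : ℤ) ∣ c)) :
    ¬ (sphereDist x y < r ∧ sphereDist x (ω ^ c • y) < r) := by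
  rintro ⟨h₁, h₂⟩
  have hq' : (2 : ℝ) ≤ q := by exact_mod_cast hq
  have hωc : ω ^ c = Complex.exp ((c * (2 * π / q) : ℝ) * Complex.I) := by
    rw [hω, ← Complex.exp_int_mul]
    congr 1
    push_cast
    ring
  have hz : ‖ω ^ c • y‖ = 1 := by
    rw [norm_smul, hωc, Complex.norm_exp_ofReal_mul_I, hy, one_mul]
  have htri := sphereDist_triangle hy hx hz
  have hlow : 2 * π / q ≤ sphereDist y (ω ^ c • y) := by
    rw [hωc, sphereDist_exp_smul hy]
    exact two_pi_div_le_arccos_cos (by lia) hc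
  have hr' : 2 * r ≤ 2 * π / q := by
    calc 2 * r ≤ 2 * (2 * π / (q * (q + 1))) := by gcongr
      _ = 2 * π / q * (2 / (q + 1)) := by field_simp
      _ ≤ 2 * π / q * 1 := by
        gcongr
        rw [div_le_one (by positivity)]
        linarith
      _ = 2 * π / q := mul_one _
  rw [sphereDist_comm y x] at htri
  linarith
end
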